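/- Let n ≥ 2, c > 0, μ ∈ ℝ, σ > 0, η > 0, and let N^n_{(μ,σ)} be the n-fold product on ℝⁿ of the normal distribution N(μ,σ²). Then N^n_{(μ,σ)}({x ∈ ℝⁿ : c·n·σ²·e^{−2η} ≤ S̄(x) ≤ c·n·σ²·e^{2η}}) = ∫_{c·n·e^{−2η}}^{c·n·e^{2η}} p^{χ²}_{n−1}(x) dx. In particular this probability does not depend on (μ,σ). -/

import Mathlib

open MeasureTheory ProbabilityTheory

/-- The chi-squared density with `m` degrees of freedom. -/
noncomputable def chiSqPDF (m : ℕ) (x : ℝ) : ℝ :=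
  x ^ ((m : ℝ) / 2 - 1) * Real.exp (-x / 2) /
    (2 ^ ((m : ℝ) / 2) * Real.Gamma ((m : ℝ) / 2))

lemma band_meas {α : Type*} [MeasurableSpace α] (f : α → ℝ) (hf : Measurable f) (a b : ℝ) :
    MeasurableSet {x | a ≤ f x ∧ f x ≤ b} :=
  (measurableSet_le measurable_const hf).inter (measurableSet_le hf measurable_const)

lemma pi_gauss_eq (m : ℕ) :
    (Measure.pi fun _ : Fin m => gaussianReal 0 1) =
      (volume : Measure (Fin m → ℝ)).withDensity
        (fun x => ENNReal.ofReal (∏ i, gaussianPDFReal 0 1 (x i))) := by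
  refine Measure.pi_eq fun s hs => ?_
  rw [withDensity_apply _ (MeasurableSet.univ_pi hs), volume_pi, Measure.restrict_pi_pi,
    ← ofReal_integral_eq_lintegral_ofReal, integral_fintype_prod_eq_prod,
    ENNReal.ofReal_prod_of_nonneg]
  · refine Finset.prod_congr rfl fun i _ => ?_
    rw [gaussianReal_apply_eq_integral _ one_ne_zero]
  · intro i _
    exact integral_nonneg fun x => gaussianPDFReal_nonneg _ _ _
  · exact Integrable.fintype_prod fun i => (integrable_gaussianPDFReal 0 1).restrict
  · exact Filter.Eventually.of_forall fun x =>
      Finset.prod_nonneg fun i _ => gaussianPDFReal_nonneg _ _ _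

lemma prod_pdf (m : ℕ) (x : EuclideanSpace ℝ (Fin m)) :
    ∏ i, gaussianPDFReal 0 1 (x i) =
      (√(2 * Real.pi))⁻¹ ^ m * Real.exp (- ‖x‖ ^ 2 / 2) := by
  simp only [gaussianPDFReal, Finset.prod_mul_distrib, ← Real.exp_sum]
  simp [EuclideanSpace.real_norm_sq_eq, ← Finset.sum_div]

lemma radial_sub (m : ℕ) (hm : 1 ≤ m) (a b : ℝ) (ha : 0 < a) (hab : a ≤ b) :
    (m : ℝ) * (√Real.pi ^ m / Real.Gamma (m / 2 + 1)) *
      ∫ r in (√a)..(√b), r ^ (m - 1) * ((√(2 * Real.pi))⁻¹ ^ m * Real.exp (- r ^ 2 / 2))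
      = ∫ t in a..b, chiSqPDF m t := by
  have hsa : 0 < √a := Real.sqrt_pos.2 ha
  have hsab : √a ≤ √b := Real.sqrt_le_sqrt hab
  have h := intervalIntegral.integral_comp_mul_deriv' (a := √a) (b := √b) (f := fun r => r ^ 2)
    (f' := fun r => 2 * r) (g := chiSqPDF m) (fun x _ => by simpa using hasDerivAt_pow 2 x)
    (by fun_prop) (by
      rintro _ ⟨x, hx, rfl⟩
      rw [Set.uIcc_of_le hsab] at hx
      have hx0 : 0 < x := hsa.trans_le hx.1
      refine ContinuousAt.continuousWithinAt ?_
      unfold chiSqPDF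
      refine ContinuousAt.div_const (ContinuousAt.mul ?_ (by fun_prop)) _
      exact Real.continuousAt_rpow_const _ _ (Or.inl (by positivity)))
  simp only [Real.sq_sqrt ha.le, Real.sq_sqrt (ha.le.trans hab)] at h
  rw [← h, ← intervalIntegral.integral_const_mul]
  refine intervalIntegral.integral_congr fun r hr => ?_
  rw [Set.uIcc_of_le hsab] at hr
  have hr0 : 0 < r := hsa.trans_le hr.1
  have hm0 : (0 : ℝ) < m := by exact_mod_cast hm
  have hG : Real.Gamma ((m : ℝ) / 2 + 1) = m / 2 * Real.Gamma (m / 2) :=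
    Real.Gamma_add_one (by positivity)
  have hGp : 0 < Real.Gamma ((m : ℝ) / 2) := Real.Gamma_pos_of_pos (by positivity)
  have h2 : (2 : ℝ) ^ ((m : ℝ) / 2) = √2 ^ m := by
    rw [Real.sqrt_eq_rpow, ← Real.rpow_natCast, ← Real.rpow_mul (by norm_num)]
    congr 1; ring
  have hr2 : (r ^ 2) ^ ((m : ℝ) / 2 - 1) * r = r ^ (m - 1) := by
    rw [← Real.rpow_natCast r 2, ← Real.rpow_mul hr0.le, ← Real.rpow_natCast r (m - 1),
      ← Real.rpow_add_one hr0.ne']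
    congr 1
    push_cast [Nat.cast_sub hm]; ring
  simp only [Function.comp, chiSqPDF]
  rw [hG, h2, ← hr2, Real.sqrt_mul (by norm_num)]
  have hpi : 0 < √Real.pi := Real.sqrt_pos.2 Real.pi_pos
  have h22 : 0 < √(2 : ℝ) := by positivity
  rw [inv_pow, mul_pow]
  field_simp

lemma chi_band (m : ℕ) (hm : 1 ≤ m) (a b : ℝ) (ha : 0 < a) (hab : a ≤ b) :
    (Measure.pi fun _ : Fin m => gaussianReal 0 1)
      {y : Fin m → ℝ | a ≤ ∑ i, y i ^ 2 ∧ ∑ i, y i ^ 2 ≤ b}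
      = ENNReal.ofReal (∫ t in a..b, chiSqPDF m t) := by
  have : Nonempty (Fin m) := ⟨⟨0, hm⟩⟩
  have hS : MeasurableSet {y : Fin m → ℝ | a ≤ ∑ i, y i ^ 2 ∧ ∑ i, y i ^ 2 ≤ b} := by
    exact band_meas _ (by fun_prop) _ _
  have hint : Integrable (fun x : Fin m → ℝ => ∏ i, gaussianPDFReal 0 1 (x i)) :=
    Integrable.fintype_prod fun i => (integrable_gaussianPDFReal 0 1)
  have hsab : √a ≤ √b := Real.sqrt_le_sqrt hab
  rw [pi_gauss_eq, withDensity_apply _ hS, ← ofReal_integral_eq_lintegral_ofReal hint.restrict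
    (Filter.Eventually.of_forall fun x =>
      Finset.prod_nonneg fun i _ => gaussianPDFReal_nonneg _ _ _)]
  congr 1
  rw [← integral_indicator hS,
    ← (EuclideanSpace.volume_preserving_symm_measurableEquiv_toLp (Fin m)).integral_comp',
    ← radial_sub m hm a b ha hab]
  have key := integral_fun_norm_addHaar (volume : Measure (EuclideanSpace ℝ (Fin m)))
    ((Set.Icc (√a) (√b)).indicator
      fun r => (√(2 * Real.pi))⁻¹ ^ m * Real.exp (- r ^ 2 / 2))
  have hvol : (volume : Measure (EuclideanSpace ℝ (Fin m))).real (Metric.ball 0 1)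
      = √Real.pi ^ m / Real.Gamma (m / 2 + 1) := by
    rw [Measure.real, EuclideanSpace.volume_ball]
    simp only [Fintype.card_fin, ENNReal.ofReal_one, one_pow, one_mul]
    exact ENNReal.toReal_ofReal (by
      have : 0 < Real.Gamma ((m : ℝ) / 2 + 1) := Real.Gamma_pos_of_pos (by positivity)
      positivity)
  rw [hvol, finrank_euclideanSpace, Fintype.card_fin] at key
  have h1 : ∫ y in Set.Ioi (0 : ℝ), y ^ (m - 1) • (Set.Icc (√a) (√b)).indicator
      (fun r => (√(2 * Real.pi))⁻¹ ^ m * Real.exp (- r ^ 2 / 2)) y =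
      ∫ r in (√a)..(√b), r ^ (m - 1) * ((√(2 * Real.pi))⁻¹ ^ m * Real.exp (- r ^ 2 / 2)) := by
    rw [intervalIntegral.integral_of_le hsab, ← integral_Icc_eq_integral_Ioc,
      ← integral_indicator measurableSet_Icc, ← integral_indicator measurableSet_Ioi]
    congr 1
    ext y
    by_cases hy : y ∈ Set.Icc (√a) (√b)
    · have : 0 < y := (Real.sqrt_pos.2 ha).trans_le hy.1
      simp [hy, this]
    · simp [Set.indicator, hy]
  rw [h1] at key
  simp only [nsmul_eq_mul, smul_eq_mul] at key
  rw [mul_assoc, ← key]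
  congr 1
  ext x
  have hx : ∑ i, x i ^ 2 = ‖x‖ ^ 2 := (EuclideanSpace.real_norm_sq_eq x).symm
  have hiff : (WithLp.ofLp x ∈ {y : Fin m → ℝ | a ≤ ∑ i, y i ^ 2 ∧ ∑ i, y i ^ 2 ≤ b}) ↔
      ‖x‖ ∈ Set.Icc (√a) (√b) := by
    simp only [Set.mem_ofPred_eq, hx, Set.mem_Icc]
    rw [Real.sqrt_le_left (norm_nonneg x), Real.le_sqrt (norm_nonneg x)]
    exact ha.le.trans hab
  change Set.indicator _ _ (WithLp.ofLp x) = _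
  by_cases h : ‖x‖ ∈ Set.Icc (√a) (√b)
  · rw [Set.indicator_of_mem h, Set.indicator_of_mem (hiff.2 h), prod_pdf]
  · rw [Set.indicator_of_notMem h, Set.indicator_of_notMem (fun h' => h (hiff.1 h'))]

lemma std_band (m : ℕ) (a b : ℝ) :
    (Measure.pi fun _ : Fin (m + 1) => gaussianReal 0 1)
        {x : Fin (m + 1) → ℝ |
          a ≤ (∑ k, (x k - (∑ j, x j) / (m + 1 : ℕ)) ^ 2) ∧
          (∑ k, (x k - (∑ j, x j) / (m + 1 : ℕ)) ^ 2) ≤ b}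
    = (Measure.pi fun _ : Fin m => gaussianReal 0 1)
      {y : Fin m → ℝ | a ≤ ∑ i, y i ^ 2 ∧ ∑ i, y i ^ 2 ≤ b} := by
  have hN : (0 : ℝ) < (m + 1 : ℕ) := by positivity
  set N : ℝ := ((m + 1 : ℕ) : ℝ) with hNdef
  let v : EuclideanSpace ℝ (Fin (m + 1)) := WithLp.toLp 2 (fun _ => (√N)⁻¹)
  have hv : ‖v‖ = 1 := by
    have : ‖v‖ ^ 2 = 1 := by
      rw [EuclideanSpace.real_norm_sq_eq]
      simp only [v, Finset.sum_const, Finset.card_univ, Fintype.card_fin, nsmul_eq_mul, inv_pow,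
        Real.sq_sqrt hN.le]
      exact mul_inv_cancel₀ hN.ne'
    nlinarith [norm_nonneg v]
  obtain ⟨B, hB⟩ := Orthonormal.exists_orthonormalBasis_extension_of_card_eq (𝕜 := ℝ)
    (E := EuclideanSpace ℝ (Fin (m + 1))) (ι := Fin (m + 1)) (by simp)
    (v := fun _ => v) (s := {0}) (by
      constructor
      · intro i; exact hv
      · intro i j hij; exact absurd (Subsingleton.elim i j) hij)
  have hB0 : B 0 = v := hB 0 rfl
  have hS : MeasurableSet {x : Fin (m + 1) → ℝ |
          a ≤ (∑ k, (x k - (∑ j, x j) / N) ^ 2) ∧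
          (∑ k, (x k - (∑ j, x j) / N) ^ 2) ≤ b} := by
    exact band_meas _ (by fun_prop) _ _
  have hS' : MeasurableSet {y : Fin m → ℝ | a ≤ ∑ i, y i ^ 2 ∧ ∑ i, y i ^ 2 ≤ b} := by
    exact band_meas _ (by fun_prop) _ _
  -- rotation invariance
  have hrot : (Measure.pi fun _ : Fin (m + 1) => gaussianReal 0 1).map
      (fun y => WithLp.ofLp (∑ i, y i • B i)) = Measure.pi fun _ : Fin (m + 1) => gaussianReal 0 1 := by
    have e1 := stdGaussian_eq_map_pi_orthonormalBasis B
    have e2 := map_pi_eq_stdGaussian (ι := Fin (m + 1))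
    have e3 := congrArg (Measure.map (WithLp.ofLp (p := 2) (V := Fin (m + 1) → ℝ))) (e2.trans e1)
    rw [Measure.map_map (by fun_prop) (by fun_prop),
      Measure.map_map (by fun_prop) (by fun_prop)] at e3
    have : (WithLp.ofLp (p := 2) (V := Fin (m + 1) → ℝ)) ∘ WithLp.toLp 2 = id := rfl
    rw [this, Measure.map_id] at e3
    exact e3.symm
  have hsum : ∀ y : Fin (m + 1) → ℝ,
      ∑ k, ((∑ i, y i • B i) k - (∑ j, (∑ i, y i • B i) j) / N) ^ 2
        = ∑ i : Fin m, y i.succ ^ 2 := by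
    intro y
    set x : EuclideanSpace ℝ (Fin (m + 1)) := ∑ i, y i • B i with hx
    have hn : ∑ k, x k ^ 2 = y 0 ^ 2 + ∑ i : Fin m, y i.succ ^ 2 := by
      rw [← EuclideanSpace.real_norm_sq_eq, ← real_inner_self_eq_norm_sq, hx,
        B.orthonormal.inner_sum, Fin.sum_univ_succ]
      simp [sq]
    have hi : inner ℝ v x = y 0 := by
      rw [← hB0, hx, B.orthonormal.inner_right_fintype]
    have hi' : inner ℝ v x = (√N)⁻¹ * ∑ j, x j := by
      rw [PiLp.inner_apply, Finset.mul_sum]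
      refine Finset.sum_congr rfl fun j _ => ?_
      simp [v, mul_comm]
    have hT : (∑ j, x j) ^ 2 = N * y 0 ^ 2 := by
      have h0 : y 0 = (√N)⁻¹ * ∑ j, x j := hi.symm.trans hi'
      rw [h0, mul_pow, inv_pow, Real.sq_sqrt hN.le]
      field_simp
    have : ∑ k, (x k - (∑ j, x j) / N) ^ 2 = ∑ k, x k ^ 2 - (∑ j, x j) ^ 2 / N := by
      set T := ∑ j, x j with hTd
      have : ∀ k, (x k - T / N) ^ 2 = x k ^ 2 - 2 * (T / N) * x k + (T / N) ^ 2 := fun k => by ring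
      simp only [this, Finset.sum_add_distrib, Finset.sum_sub_distrib, ← Finset.mul_sum, ← hTd]
      simp only [Finset.sum_const, Finset.card_univ, Fintype.card_fin, nsmul_eq_mul, ← hNdef]
      field_simp
      ring
    rw [this, hT, hn]
    field_simp
    ring
  rw [← hrot, Measure.map_apply (by fun_prop) hS]
  have hmp := measurePreserving_piFinSuccAbove
    (fun _ : Fin (m + 1) => gaussianReal 0 1) 0
  have hpre : (fun y : Fin (m + 1) → ℝ => WithLp.ofLp (∑ i, y i • B i)) ⁻¹'
      {x : Fin (m + 1) → ℝ |
          a ≤ (∑ k, (x k - (∑ j, x j) / N) ^ 2) ∧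
          (∑ k, (x k - (∑ j, x j) / N) ^ 2) ≤ b} =
      (MeasurableEquiv.piFinSuccAbove (fun _ : Fin (m + 1) => ℝ) 0) ⁻¹'
        (Set.univ ×ˢ {y : Fin m → ℝ | a ≤ ∑ i, y i ^ 2 ∧ ∑ i, y i ^ 2 ≤ b}) := by
    ext y
    simp only [Set.mem_preimage, Set.mem_ofPred_eq, hsum, Set.mem_prod, Set.mem_univ, true_and]
    rfl
  rw [hpre, hmp.measure_preimage (MeasurableSet.univ.prod hS').nullMeasurableSet,
    Measure.prod_prod, measure_univ, one_mul]

/-- probability of the scaled variance band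
`[cnσ²e^{-2η}, cnσ²e^{2η}]` for `S̄(x)`, a chi-squared integral independent
of `(μ, σ)`. -/
theorem sample_variance_scaled_band_prob
    (n : ℕ) (hn : 2 ≤ n) (c μ σ η : ℝ) (hc : 0 < c) (hσ : 0 < σ) (hη : 0 < η) :
    (Measure.pi fun _ : Fin n => gaussianReal μ (Real.toNNReal (σ ^ 2)))
        {x : Fin n → ℝ |
          c * n * σ ^ 2 * Real.exp (-2 * η) ≤ (∑ k, (x k - (∑ j, x j) / n) ^ 2) ∧
          (∑ k, (x k - (∑ j, x j) / n) ^ 2) ≤ c * n * σ ^ 2 * Real.exp (2 * η)}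
      = ENNReal.ofReal
          (∫ t in (c * n * Real.exp (-2 * η))..(c * n * Real.exp (2 * η)),
            chiSqPDF (n - 1) t) := by
  obtain ⟨m, rfl⟩ : ∃ m, n = m + 1 := ⟨n - 1, by omega⟩
  have hN : (0 : ℝ) < (m + 1 : ℕ) := by positivity
  rw [Nat.add_sub_cancel, ← chi_band m (by omega) _ _ (by positivity)
    (by gcongr; linarith), ← std_band]
  have hg : (gaussianReal 0 1).map (fun x => σ * x + μ) =
      gaussianReal μ (Real.toNNReal (σ ^ 2)) := by
    have h1 := gaussianReal_map_const_mul (μ := 0) (v := 1) σ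
    have h2 := congrArg (Measure.map (· + μ)) h1
    rw [gaussianReal_map_add_const, Measure.map_map (by fun_prop) (by fun_prop)] at h2
    rw [show (fun x => σ * x + μ) = (· + μ) ∘ (σ * ·) from rfl, h2]
    congr 1
    · simp
    · ext; simp [Real.coe_toNNReal _ (sq_nonneg σ)]
  have hpi := Measure.pi_map_pi (ι := Fin (m + 1)) (μ := fun _ => gaussianReal 0 1)
    (f := fun _ x => σ * x + μ) (hμ := fun _ => by rw [hg]; infer_instance)
    (fun _ => by fun_prop)
  simp only [hg] at hpi
  rw [← hpi, Measure.map_apply (by fun_prop)]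
  · congr 1
    ext x
    have hs : ∑ k, ((σ * x k + μ) - (∑ j, (σ * x j + μ)) / (m + 1 : ℕ)) ^ 2 =
        σ ^ 2 * ∑ k, (x k - (∑ j, x j) / (m + 1 : ℕ)) ^ 2 := by
      rw [Finset.mul_sum]
      refine Finset.sum_congr rfl fun k _ => ?_
      rw [Finset.sum_add_distrib, ← Finset.mul_sum]
      simp only [Finset.sum_const, Finset.card_univ, Fintype.card_fin, nsmul_eq_mul]
      field_simp
      ring
    have hσ2 : 0 < σ ^ 2 := by positivity
    simp only [Set.mem_preimage, Set.mem_ofPred_eq, hs]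
    rw [show c * ((m + 1 : ℕ) : ℝ) * σ ^ 2 * Real.exp (-2 * η) =
        σ ^ 2 * (c * ((m + 1 : ℕ) : ℝ) * Real.exp (-2 * η)) by ring,
      show c * ((m + 1 : ℕ) : ℝ) * σ ^ 2 * Real.exp (2 * η) =
        σ ^ 2 * (c * ((m + 1 : ℕ) : ℝ) * Real.exp (2 * η)) by ring,
      mul_le_mul_iff_right₀ hσ2, mul_le_mul_iff_right₀ hσ2]
  · exact band_meas _ (by fun_prop) _ _
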